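/- arXiv:1701.06347 — 11 statements merged into one kernel-verified Lean document; each statement's English description precedes it below -/
import Mathlib

section
/- Fix α>0, α≠1, and a σ-finite measure μ on a measurable space (𝕏,𝒳). Let P and Q be probability measures absolutely continuous with respect to μ with μ-densities p and q satisfying 0 < ∫ p^α dμ < ∞ and 0 < ∫ q^α dμ < ∞. Then the relative α-entropy of P with respect to Q equals the Rényi divergence of order 1/α between the α-scaled measures of P and Q: 𝓘_α(P,Q) = D_{1/α}(P^{(α)} ‖ Q^{(α)}). -/
open MeasureTheory Real

/-- The `1/a`-th power undoes the scaling `t ↦ t ^ a / c` up to the factor `c ^ (1/a)`. -/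
theorem div_rpow_one_div_eq {a t c : ℝ} (ha : a ≠ 0) (ht : 0 ≤ t) (hc : 0 ≤ c) :
    (t ^ a / c) ^ (1 / a) = t / c ^ (1 / a) := by
  rw [Real.div_rpow (Real.rpow_nonneg ht a) hc, ← Real.rpow_mul ht, mul_one_div_cancel ha,
    Real.rpow_one]

/-- For `α > 0`, `α ≠ 1`, and probability densities `p, q` with respect to a
σ-finite measure `μ` whose `α`-th power integrals are finite and positive, the relative
`α`-entropy `𝓘_α(P,Q)` equals the Rényi divergence of order `1/α` between the `α`-scaled
measures, `D_{1/α}(P^{(α)} ‖ Q^{(α)})`. -/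
theorem relAlphaEntropy_eq_renyiDiv_scaled
    {X : Type*} [MeasurableSpace X] (μ : Measure X) [SigmaFinite μ]
    (α : ℝ) (hα : 0 < α) (hα1 : α ≠ 1)
    (p q : X → ℝ) (hp_meas : Measurable p) (hq_meas : Measurable q)
    (hp_nonneg : ∀ x, 0 ≤ p x) (hq_nonneg : ∀ x, 0 ≤ q x)
    (hp1 : ∫ x, p x ∂μ = 1) (hq1 : ∫ x, q x ∂μ = 1)
    (hpα_int : Integrable (fun x => p x ^ α) μ) (hqα_int : Integrable (fun x => q x ^ α) μ)
    (hpα_pos : 0 < ∫ x, p x ^ α ∂μ) (hqα_pos : 0 < ∫ x, q x ^ α ∂μ) :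
    (α / (1 - α)) * Real.log (∫ x,
        (p x / (∫ y, p y ^ α ∂μ) ^ (1/α)) * (q x / (∫ y, q y ^ α ∂μ) ^ (1/α)) ^ (α - 1) ∂μ)
      = (1 / (1/α - 1)) * Real.log (∫ x,
        (p x ^ α / ∫ y, p y ^ α ∂μ) ^ (1/α) * (q x ^ α / ∫ y, q y ^ α ∂μ) ^ (1 - 1/α) ∂μ) := by
  have hcoef : α / (1 - α) = 1 / (1 / α - 1) := by
    have : 1 - α ≠ 0 := sub_ne_zero.mpr hα1.symm
    rw [show 1 / α - 1 = (1 - α) / α by field_simp, one_div_div]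
  rw [hcoef]
  congr 3
  funext x
  rw [div_rpow_one_div_eq hα.ne' (hp_nonneg x) hpα_pos.le,
    ← div_rpow_one_div_eq hα.ne' (hq_nonneg x) hqα_pos.le,
    ← Real.rpow_mul (div_nonneg (Real.rpow_nonneg (hq_nonneg x) α) hqα_pos.le)]
  congr 2
  field_simp
end

section
/- Fix α>0, α≠1, and a σ-finite measure μ on a measurable space (𝕏,𝒳). Let 𝔼 be a set of probability measures absolutely continuous with respect to μ whose μ-densities p all satisfy 0 < ∫ p^α dμ < ∞, and let 𝔼^{(α)} = {P^{(α)} : P ∈ 𝔼} be the corresponding set of α-scaled measures. Then 𝔼 is convex (closed under ordinary mixtures λP₁ + (1−λ)P₀ for all λ ∈ (0,1)) if and only if 𝔼^{(α)} is (1/α)-convex (closed under (1/α,λ)-mixtures for all λ ∈ (0,1)). -/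
open MeasureTheory ENNReal

/-- The `α`-scaled measure `P^{(α)}` of a probability measure `P ≪ μ`: the measure with
`μ`-density `p^α / ∫ p^α dμ`, where `p = dP/dμ`. -/
noncomputable def scaledMeasure {X : Type*} [MeasurableSpace X]
    (μ : Measure X) (α : ℝ) (P : Measure X) : Measure X :=
  μ.withDensity (fun x => (P.rnDeriv μ x) ^ α / ∫⁻ y, (P.rnDeriv μ y) ^ α ∂μ)

/-- The `(β,λ)`-mixture of probability measures `P₀, P₁ ≪ μ`: the measure with `μ`-density
proportional to `(λ p₁^β + (1-λ) p₀^β)^{1/β}`. -/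
noncomputable def betaMixture {X : Type*} [MeasurableSpace X]
    (μ : Measure X) (β l : ℝ) (P₀ P₁ : Measure X) : Measure X :=
  μ.withDensity (fun x =>
    (ENNReal.ofReal l * (P₁.rnDeriv μ x) ^ β
        + ENNReal.ofReal (1 - l) * (P₀.rnDeriv μ x) ^ β) ^ (1/β)
      / ∫⁻ y, (ENNReal.ofReal l * (P₁.rnDeriv μ y) ^ β
        + ENNReal.ofReal (1 - l) * (P₀.rnDeriv μ y) ^ β) ^ (1/β) ∂μ)

theorem rnDeriv_scaledMeasure {X : Type*} [MeasurableSpace X]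
    (μ : Measure X) [SigmaFinite μ] (α : ℝ) (P : Measure X) :
    (scaledMeasure μ α P).rnDeriv μ =ᵐ[μ]
      fun x => (P.rnDeriv μ x) ^ α / ∫⁻ y, (P.rnDeriv μ y) ^ α ∂μ :=
  Measure.rnDeriv_withDensity μ (((Measure.measurable_rnDeriv P μ).pow_const α).div_const _)

/-- The mixture weights of the scaled measures are those of the original measures multiplied by
the norms of the densities and a common factor `k`. -/
theorem betaMixture_scaledMeasure {X : Type*} [MeasurableSpace X]
    (μ : Measure X) [SigmaFinite μ] {α : ℝ} (hα : 0 < α)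
    (P₀ P₁ : Measure X) [IsFiniteMeasure P₀] [IsFiniteMeasure P₁] {l l' k n₀ n₁ : ℝ}
    (hn₀ : 0 < n₀) (hn₁ : 0 < n₁) (hk : 0 < k)
    (h₀ : (∫⁻ x, (P₀.rnDeriv μ x) ^ α ∂μ) ^ (1 / α) = ENNReal.ofReal n₀)
    (h₁ : (∫⁻ x, (P₁.rnDeriv μ x) ^ α ∂μ) ^ (1 / α) = ENNReal.ofReal n₁)
    (hl : l = k * l' * n₁) (hl' : 1 - l = k * (1 - l') * n₀) :
    betaMixture μ (1 / α) l (scaledMeasure μ α P₀) (scaledMeasure μ α P₁) =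
      scaledMeasure μ α (ENNReal.ofReal l' • P₁ + ENNReal.ofReal (1 - l') • P₀) := by
  set Q := ENNReal.ofReal l' • P₁ + ENNReal.ofReal (1 - l') • P₀ with hQ
  have hK0 : ENNReal.ofReal k ^ α ≠ 0 := by
    simp [ENNReal.rpow_eq_zero_iff, hk, hα]
  have hKt : ENNReal.ofReal k ^ α ≠ ⊤ := ENNReal.rpow_ne_top_of_nonneg hα.le ENNReal.ofReal_ne_top
  have cancel : ∀ (m w n : ℝ) (p c : ℝ≥0∞), 0 < n → c ^ (1 / α) = ENNReal.ofReal n →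
      m = k * w * n →
      ENNReal.ofReal m * (p ^ α / c) ^ (1 / α) = ENNReal.ofReal k * (ENNReal.ofReal w * p) := by
    intro m w n p c hn hc hm
    have hn0 : ENNReal.ofReal n ≠ 0 := by simpa using hn
    rw [ENNReal.div_rpow_of_nonneg _ _ (by positivity), hc, ← ENNReal.rpow_mul,
      mul_one_div_cancel hα.ne', ENNReal.rpow_one, hm, mul_assoc, ENNReal.ofReal_mul hk.le,
      ENNReal.ofReal_mul' hn.le, mul_assoc, mul_assoc,
      ENNReal.mul_div_cancel hn0 ENNReal.ofReal_ne_top]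
  have hQd : Q.rnDeriv μ =ᵐ[μ] fun x =>
      ENNReal.ofReal l' * P₁.rnDeriv μ x + ENNReal.ofReal (1 - l') * P₀.rnDeriv μ x := by
    have : IsFiniteMeasure (ENNReal.ofReal l' • P₁) :=
      Measure.smul_finite P₁ ENNReal.ofReal_ne_top
    have : IsFiniteMeasure (ENNReal.ofReal (1 - l') • P₀) :=
      Measure.smul_finite P₀ ENNReal.ofReal_ne_top
    filter_upwards [Measure.rnDeriv_add (ENNReal.ofReal l' • P₁) (ENNReal.ofReal (1 - l') • P₀) μ,
      Measure.rnDeriv_smul_left_of_ne_top P₁ μ (ENNReal.ofReal_ne_top (r := l')),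
      Measure.rnDeriv_smul_left_of_ne_top P₀ μ (ENNReal.ofReal_ne_top (r := 1 - l'))]
      with x hx hx₁ hx₀
    rw [hQ, hx, Pi.add_apply, hx₁, hx₀]
    simp
  have key : (fun x => (ENNReal.ofReal l * ((scaledMeasure μ α P₁).rnDeriv μ x) ^ (1 / α)
        + ENNReal.ofReal (1 - l) * ((scaledMeasure μ α P₀).rnDeriv μ x) ^ (1 / α))
          ^ (1 / (1 / α))) =ᵐ[μ] fun x => ENNReal.ofReal k ^ α * (Q.rnDeriv μ x) ^ α := by
    filter_upwards [hQd, rnDeriv_scaledMeasure μ α P₁, rnDeriv_scaledMeasure μ α P₀]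
      with x hx hx₁ hx₀
    rw [hx, hx₁, hx₀, cancel _ _ _ _ _ hn₁ h₁ hl, cancel _ _ _ _ _ hn₀ h₀ hl', ← mul_add,
      one_div_one_div, ENNReal.mul_rpow_of_nonneg _ _ hα.le]
  unfold betaMixture scaledMeasure
  apply withDensity_congr_ae
  have hint := lintegral_congr_ae key
  rw [lintegral_const_mul _ ((Measure.measurable_rnDeriv Q μ).pow_const α)] at hint
  unfold scaledMeasure at hint key
  filter_upwards [key] with x hx
  rw [hx, hint, ENNReal.mul_div_mul_left _ _ hK0 hKt]

theorem eq_of_scaledMeasure_eq {X : Type*} [MeasurableSpace X]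
    (μ : Measure X) [SigmaFinite μ] {α : ℝ} (hα : 0 < α)
    (P Q : Measure X) [IsProbabilityMeasure P] [IsProbabilityMeasure Q]
    (hP : P ≪ μ) (hQ : Q ≪ μ)
    (hQ0 : ∫⁻ x, (Q.rnDeriv μ x) ^ α ∂μ ≠ 0) (hQt : ∫⁻ x, (Q.rnDeriv μ x) ^ α ∂μ ≠ ⊤)
    (h : scaledMeasure μ α P = scaledMeasure μ α Q) : P = Q := by
  have hd := (rnDeriv_scaledMeasure μ α P).symm.trans
    ((Filter.EventuallyEq.of_eq (by rw [h])).trans (rnDeriv_scaledMeasure μ α Q))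
  set c := ∫⁻ x, (P.rnDeriv μ x) ^ α ∂μ with hc
  set d := ∫⁻ x, (Q.rnDeriv μ x) ^ α ∂μ with hd'
  have hPint : ∫⁻ x, P.rnDeriv μ x ∂μ = 1 := by
    rw [Measure.lintegral_rnDeriv hP, measure_univ]
  have hQint : ∫⁻ x, Q.rnDeriv μ x ∂μ = 1 := by
    rw [Measure.lintegral_rnDeriv hQ, measure_univ]
  have hc0 : c ≠ 0 := by
    intro h0
    rw [hc, lintegral_eq_zero_iff ((Measure.measurable_rnDeriv P μ).pow_const α)] at h0
    have : P.rnDeriv μ =ᵐ[μ] 0 := by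
      filter_upwards [h0] with x hx
      exact (ENNReal.rpow_eq_zero_iff_of_pos hα).1 hx
    rw [lintegral_congr_ae this] at hPint
    simp at hPint
  have hct : c ≠ ⊤ := by
    intro ht
    have := lintegral_congr_ae hd
    simp only [ht, div_eq_mul_inv] at this
    rw [lintegral_mul_const _ ((Measure.measurable_rnDeriv Q μ).pow_const α), ← hd',
      ENNReal.mul_inv_cancel hQ0 hQt] at this
    simp at this
  have hroot : P.rnDeriv μ =ᵐ[μ] fun x => (c / d) ^ (1 / α) * Q.rnDeriv μ x := by
    filter_upwards [hd] with x hx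
    have hx' : (P.rnDeriv μ x) ^ α = c / d * (Q.rnDeriv μ x) ^ α := by
      rw [← ENNReal.div_mul_cancel hc0 hct (b := (P.rnDeriv μ x) ^ α), hx]
      simp only [div_eq_mul_inv]
      ring
    rw [← ENNReal.rpow_rpow_inv hα.ne' (P.rnDeriv μ x), hx',
      ENNReal.mul_rpow_of_nonneg _ _ (by positivity), ENNReal.rpow_rpow_inv hα.ne', one_div]
  have hone : (c / d) ^ (1 / α) = 1 := by
    rw [lintegral_congr_ae hroot, lintegral_const_mul _ (Measure.measurable_rnDeriv Q μ), hQint,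
      mul_one] at hPint
    exact hPint
  rw [← Measure.withDensity_rnDeriv_eq P μ hP, ← Measure.withDensity_rnDeriv_eq Q μ hQ]
  apply withDensity_congr_ae
  filter_upwards [hroot] with x hx
  rw [hx, hone, one_mul]

theorem exists_rpow_eq_ofReal {c : ℝ≥0∞} (h0 : 0 < c) (ht : c < ⊤) (s : ℝ) :
    ∃ n : ℝ, 0 < n ∧ c ^ s = ENNReal.ofReal n := by
  have h1 : c ^ s ≠ ⊤ := ENNReal.rpow_ne_top_of_ne_zero h0.ne' ht.ne
  exact ⟨(c ^ s).toReal, ENNReal.toReal_pos (ENNReal.rpow_pos h0 ht.ne).ne' h1,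
    (ENNReal.ofReal_toReal h1).symm⟩

/-- For `α > 0`, `α ≠ 1` and a set `𝔼` of probability measures absolutely
continuous with respect to a σ-finite measure `μ`, whose densities have finite positive `α`-th
power integrals, `𝔼` is convex (closed under ordinary mixtures) if and only if the set
`𝔼^{(α)}` of `α`-scaled measures is `(1/α)`-convex (closed under `(1/α,λ)`-mixtures). -/
theorem convex_iff_scaled_invAlphaConvex
    {X : Type*} [MeasurableSpace X] (μ : Measure X) [SigmaFinite μ]
    (α : ℝ) (hα : 0 < α) (hα1 : α ≠ 1)
    (E : Set (Measure X))
    (hprob : ∀ P ∈ E, IsProbabilityMeasure P)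
    (hac : ∀ P ∈ E, P ≪ μ)
    (hfin : ∀ P ∈ E, 0 < ∫⁻ x, (P.rnDeriv μ x) ^ α ∂μ ∧ ∫⁻ x, (P.rnDeriv μ x) ^ α ∂μ < ⊤) :
    (∀ P₀ ∈ E, ∀ P₁ ∈ E, ∀ l : ℝ, l ∈ Set.Ioo (0:ℝ) 1 →
        (ENNReal.ofReal l) • P₁ + (ENNReal.ofReal (1 - l)) • P₀ ∈ E) ↔
    (∀ P₀' ∈ scaledMeasure μ α '' E, ∀ P₁' ∈ scaledMeasure μ α '' E, ∀ l : ℝ,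
        l ∈ Set.Ioo (0:ℝ) 1 →
        betaMixture μ (1/α) l P₀' P₁' ∈ scaledMeasure μ α '' E) := by
  constructor
  · rintro h _ ⟨P₀, hP₀, rfl⟩ _ ⟨P₁, hP₁, rfl⟩ l ⟨hl0, hl1⟩
    have := hprob P₀ hP₀
    have := hprob P₁ hP₁
    obtain ⟨n₀, hn₀, h₀⟩ := exists_rpow_eq_ofReal (hfin P₀ hP₀).1 (hfin P₀ hP₀).2 (1 / α)
    obtain ⟨n₁, hn₁, h₁⟩ := exists_rpow_eq_ofReal (hfin P₁ hP₁).1 (hfin P₁ hP₁).2 (1 / α)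
    have hl1' : 0 < 1 - l := sub_pos.2 hl1
    have ha : 0 < l / n₁ := by positivity
    have hb : 0 < (1 - l) / n₀ := by positivity
    have hk : 0 < l / n₁ + (1 - l) / n₀ := by positivity
    have hsub : 1 - l / n₁ / (l / n₁ + (1 - l) / n₀)
        = (1 - l) / n₀ / (l / n₁ + (1 - l) / n₀) := by
      rw [eq_div_iff hk.ne', sub_mul, div_mul_cancel₀ _ hk.ne']
      ring
    refine ⟨_, h P₀ hP₀ P₁ hP₁ (l / n₁ / (l / n₁ + (1 - l) / n₀)) ⟨by positivity, ?_⟩,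
      (betaMixture_scaledMeasure μ hα P₀ P₁ hn₀ hn₁ hk h₀ h₁ ?_ ?_).symm⟩
    · rw [div_lt_one hk]
      linarith
    · rw [mul_div_cancel₀ _ hk.ne', div_mul_cancel₀ _ hn₁.ne']
    · rw [hsub, mul_div_cancel₀ _ hk.ne', div_mul_cancel₀ _ hn₀.ne']
  · rintro h P₀ hP₀ P₁ hP₁ l ⟨hl0, hl1⟩
    have := hprob P₀ hP₀
    have := hprob P₁ hP₁
    obtain ⟨n₀, hn₀, h₀⟩ := exists_rpow_eq_ofReal (hfin P₀ hP₀).1 (hfin P₀ hP₀).2 (1 / α)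
    obtain ⟨n₁, hn₁, h₁⟩ := exists_rpow_eq_ofReal (hfin P₁ hP₁).1 (hfin P₁ hP₁).2 (1 / α)
    have hl1' : 0 < 1 - l := sub_pos.2 hl1
    have hb : 0 < (1 - l) * n₀ := by positivity
    have hs : 0 < l * n₁ + (1 - l) * n₀ := by positivity
    obtain ⟨Q, hQ, hQeq⟩ := h _ ⟨P₀, hP₀, rfl⟩ _ ⟨P₁, hP₁, rfl⟩
      (l * n₁ / (l * n₁ + (1 - l) * n₀))
      ⟨by positivity, by rw [div_lt_one hs]; linarith⟩
    rw [betaMixture_scaledMeasure μ hα P₀ P₁ hn₀ hn₁ (inv_pos.2 hs) h₀ h₁ (l' := l)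
      (by field_simp) (by field_simp; ring)] at hQeq
    have := hprob Q hQ
    have : IsProbabilityMeasure (ENNReal.ofReal l • P₁ + ENNReal.ofReal (1 - l) • P₀) := by
      constructor
      simp [← ENNReal.ofReal_add hl0.le hl1'.le]
    have hmix : ENNReal.ofReal l • P₁ + ENNReal.ofReal (1 - l) • P₀ ≪ μ :=
      Measure.AbsolutelyContinuous.add_left ((hac P₁ hP₁).smul_left _) ((hac P₀ hP₀).smul_left _)
    rw [eq_of_scaledMeasure_eq μ hα _ Q hmix (hac Q hQ) (hfin Q hQ).1.ne' (hfin Q hQ).2.ne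
      hQeq.symm]
    exact hQ
end

section
/- Fix α>0, α≠1, a σ-finite measure μ, probability densities p₀, p₁ with respect to μ satisfying 0 < ∫ p₀^α dμ < ∞ and 0 < ∫ p₁^α dμ < ∞, and λ ∈ (0,1). Set λ' = (λ/‖p₁‖) / (λ/‖p₁‖ + (1−λ)/‖p₀‖), where ‖p‖ = (∫ p^α dμ)^{1/α}. Then the μ-density of the (1/α, λ)-mixture of the α-scaled measures P₀^{(α)} and P₁^{(α)} equals the α-scaled density of the ordinary mixture λ' p₁ + (1−λ') p₀; that is, (λ (p₁^{(α)})^{1/α} + (1−λ)(p₀^{(α)})^{1/α})^{α} / ∫ (λ (p₁^{(α)})^{1/α} + (1−λ)(p₀^{(α)})^{1/α})^{α} dμ = (λ' p₁ + (1−λ') p₀)^{α} / ∫ (λ' p₁ + (1−λ') p₀)^{α} dμ, μ-almost everywhere. -/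
open MeasureTheory Real

/-- For `α > 0`, `α ≠ 1`, probability densities `p₀, p₁` with finite positive
`α`-th power integrals and `λ ∈ (0,1)`, setting
`λ' = (λ/‖p₁‖) / (λ/‖p₁‖ + (1−λ)/‖p₀‖)` with `‖p‖ = (∫ p^α dμ)^{1/α}`, the density of the
`(1/α, λ)`-mixture of the `α`-scaled measures `P₀^{(α)}, P₁^{(α)}` coincides `μ`-a.e. with the
`α`-scaled density of the ordinary mixture `λ' p₁ + (1−λ') p₀`. -/
theorem mixture_of_scaled_eq_scaled_of_mixture
    {X : Type*} [MeasurableSpace X] (μ : Measure X) [SigmaFinite μ]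
    (α : ℝ) (hα : 0 < α) (hα1 : α ≠ 1)
    (p₀ p₁ : X → ℝ) (hp₀_meas : Measurable p₀) (hp₁_meas : Measurable p₁)
    (hp₀_nonneg : ∀ x, 0 ≤ p₀ x) (hp₁_nonneg : ∀ x, 0 ≤ p₁ x)
    (hp₀1 : ∫ x, p₀ x ∂μ = 1) (hp₁1 : ∫ x, p₁ x ∂μ = 1)
    (hp₀α_int : Integrable (fun x => p₀ x ^ α) μ)
    (hp₁α_int : Integrable (fun x => p₁ x ^ α) μ)
    (hp₀α_pos : 0 < ∫ x, p₀ x ^ α ∂μ) (hp₁α_pos : 0 < ∫ x, p₁ x ^ α ∂μ)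
    (l : ℝ) (hl : l ∈ Set.Ioo (0:ℝ) 1)
    (l' : ℝ)
    (hl' : l' = (l / (∫ x, p₁ x ^ α ∂μ) ^ (1/α)) /
        (l / (∫ x, p₁ x ^ α ∂μ) ^ (1/α) + (1 - l) / (∫ x, p₀ x ^ α ∂μ) ^ (1/α))) :
    (fun x =>
        (l * ((p₁ x ^ α / ∫ y, p₁ y ^ α ∂μ) ^ (1/α))
          + (1 - l) * ((p₀ x ^ α / ∫ y, p₀ y ^ α ∂μ) ^ (1/α))) ^ α
        / ∫ z, (l * ((p₁ z ^ α / ∫ y, p₁ y ^ α ∂μ) ^ (1/α))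
          + (1 - l) * ((p₀ z ^ α / ∫ y, p₀ y ^ α ∂μ) ^ (1/α))) ^ α ∂μ)
      =ᵐ[μ] (fun x =>
        (l' * p₁ x + (1 - l') * p₀ x) ^ α
          / ∫ z, (l' * p₁ z + (1 - l') * p₀ z) ^ α ∂μ) := by
  obtain ⟨hl0, hl1⟩ := hl
  set I₀ := ∫ x, p₀ x ^ α ∂μ
  set I₁ := ∫ x, p₁ x ^ α ∂μ
  have hN₀ : 0 < I₀ ^ (1/α) := rpow_pos_of_pos hp₀α_pos _
  have hN₁ : 0 < I₁ ^ (1/α) := rpow_pos_of_pos hp₁α_pos _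
  set s := l / I₁ ^ (1/α) + (1 - l) / I₀ ^ (1/α) with hs
  have hb : 0 < (1 - l) / I₀ ^ (1/α) := div_pos (sub_pos.2 hl1) hN₀
  have ha : 0 < l / I₁ ^ (1/α) := div_pos hl0 hN₁
  have hs_pos : 0 < s := add_pos ha hb
  have hmul₁ : s * l' = l / I₁ ^ (1/α) := by rw [hl', mul_div_cancel₀ _ hs_pos.ne']
  have hmul₀ : s * (1 - l') = (1 - l) / I₀ ^ (1/α) := by
    rw [mul_sub, hmul₁, hs]; ring
  have hl'0 : 0 ≤ l' := (pos_of_mul_pos_right (hmul₁ ▸ ha) hs_pos.le).le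
  have hl'1 : 0 ≤ 1 - l' := (pos_of_mul_pos_right (hmul₀ ▸ hb) hs_pos.le).le
  have hroot : ∀ p I : ℝ, 0 ≤ p → 0 < I → (p ^ α / I) ^ (1/α) = p / I ^ (1/α) := by
    intro p I hp hI
    rw [div_rpow (rpow_nonneg hp α) hI.le, ← rpow_mul hp, mul_one_div_cancel hα.ne', rpow_one]
  have hscale : ∀ x, (l * ((p₁ x ^ α / I₁) ^ (1/α)) + (1 - l) * ((p₀ x ^ α / I₀) ^ (1/α))) ^ α
      = s ^ α * (l' * p₁ x + (1 - l') * p₀ x) ^ α := by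
    intro x
    rw [hroot _ _ (hp₁_nonneg x) hp₁α_pos, hroot _ _ (hp₀_nonneg x) hp₀α_pos,
      ← mul_rpow hs_pos.le (add_nonneg (mul_nonneg hl'0 (hp₁_nonneg x))
        (mul_nonneg hl'1 (hp₀_nonneg x))),
      mul_add, ← mul_assoc, ← mul_assoc, hmul₁, hmul₀]
    congr 1
    ring
  refine .of_forall fun x => ?_
  simp only [hscale]
  rw [integral_const_mul, mul_div_mul_left _ _ (rpow_pos_of_pos hs_pos α).ne']
end

section
/- Fix α>0, α≠1, and a σ-finite measure μ. Let (fₙ) and f be nonnegative measurable functions with ∫ fₙ dμ = 1 for all n and fₙ → f in L¹(μ). Then ∫ f dμ = 1 and ∫ |fₙ^{1/α} − f^{1/α}|^α dμ → 0 as n → ∞, i.e., fₙ^{1/α} converges to f^{1/α} in the L^α(μ) metric. -/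
open MeasureTheory Real Filter

/-- The degree-one homogeneous function `|a ^ (1/α) - b ^ (1/α)| ^ α` is dominated by an arbitrarily
small multiple of `a + b` plus a large multiple of `|a - b|`. -/
lemma exists_abs_rpow_sub_rpow_le {α : ℝ} (hα : 0 < α) {ε : ℝ} (hε : 0 < ε) :
    ∃ C : ℝ, 0 ≤ C ∧ ∀ a b : ℝ, 0 ≤ a → 0 ≤ b →
      |a ^ (1/α) - b ^ (1/α)| ^ α ≤ ε * (a + b) + C * |a - b| := by
  have hp : 0 < 1 / α := by positivity
  have hcont : ContinuousAt (fun s : ℝ => |1 - s ^ (1/α)| ^ α) 1 := by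
    refine ContinuousAt.rpow_const ?_ (Or.inr hα.le)
    exact (continuousAt_const.sub
      (continuousAt_id.rpow_const (Or.inl one_ne_zero))).abs
  obtain ⟨δ, hδ, hδε⟩ := Metric.continuousAt_iff.1 hcont ε hε
  refine ⟨δ⁻¹, by positivity, fun a b ha hb => ?_⟩
  wlog hab : b ≤ a generalizing a b
  · have h := this b a hb ha (le_of_not_ge hab)
    rwa [abs_sub_comm, add_comm b a, abs_sub_comm b a] at h
  rcases ha.eq_or_lt with rfl | ha'
  · obtain rfl : b = 0 := le_antisymm hab hb
    simp [Real.zero_rpow hα.ne']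
  set s := b / a with hs
  have hs0 : 0 ≤ s := by positivity
  have hs1 : s ≤ 1 := (div_le_one ha').2 hab
  have hb' : b = a * s := by rw [hs]; field_simp
  have hsp0 : 0 ≤ s ^ (1/α) := Real.rpow_nonneg hs0 _
  have hsp1 : s ^ (1/α) ≤ 1 := Real.rpow_le_one hs0 hs1 hp.le
  have hφ : |a ^ (1/α) - b ^ (1/α)| ^ α = a * |1 - s ^ (1/α)| ^ α := by
    have hap : 0 ≤ a ^ (1/α) := Real.rpow_nonneg ha _
    rw [hb', Real.mul_rpow ha hs0, ← mul_one_sub, abs_mul, abs_of_nonneg hap,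
      Real.mul_rpow hap (abs_nonneg _), ← Real.rpow_mul ha, one_div_mul_cancel hα.ne',
      Real.rpow_one]
  rw [hφ]
  have hC : 0 ≤ δ⁻¹ * |a - b| := by positivity
  have hεb : 0 ≤ ε * b := by positivity
  by_cases hsδ : |s - 1| < δ
  · have h := hδε (x := s) (by rwa [Real.dist_eq])
    rw [Real.dist_eq, Real.one_rpow, sub_self, abs_zero, Real.zero_rpow hα.ne', sub_zero] at h
    have h' := (le_abs_self _).trans h.le
    nlinarith [mul_le_mul_of_nonneg_left h' ha]
  · have h1 : |1 - s ^ (1/α)| ^ α ≤ 1 := by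
      refine Real.rpow_le_one (abs_nonneg _) ?_ hα.le
      rw [abs_le]; constructor <;> linarith
    have h2 : a ≤ δ⁻¹ * |a - b| := by
      have h3 : |a - b| = a * |s - 1| := by
        rw [hb', abs_sub_comm, ← mul_sub_one, abs_mul, abs_of_nonneg ha]
      rw [h3, ← div_eq_inv_mul, le_div_iff₀ hδ]
      exact mul_le_mul_of_nonneg_left (not_lt.1 hsδ) ha
    nlinarith [mul_le_mul_of_nonneg_left h1 ha, mul_pos hε ha']

/-- For `α > 0`, `α ≠ 1` and a σ-finite measure `μ`, if `(fₙ)` and `f` are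
nonnegative measurable functions with `∫ fₙ dμ = 1` for all `n` and `fₙ → f` in `L¹(μ)`, then
`∫ f dμ = 1` and `fₙ^{1/α} → f^{1/α}` in the `L^α(μ)` metric, i.e.
`∫ |fₙ^{1/α} − f^{1/α}|^α dμ → 0`. -/
theorem L1_tendsto_implies_Lalpha_tendsto_of_rpow
    {X : Type*} [MeasurableSpace X] (μ : Measure X) [SigmaFinite μ]
    (α : ℝ) (hα : 0 < α) (hα1 : α ≠ 1)
    (f : ℕ → X → ℝ) (g : X → ℝ)
    (hf_meas : ∀ n, Measurable (f n)) (hg_meas : Measurable g)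
    (hf_nonneg : ∀ n x, 0 ≤ f n x) (hg_nonneg : ∀ x, 0 ≤ g x)
    (hf_one : ∀ n, ∫ x, f n x ∂μ = 1)
    (hg_int : Integrable g μ)
    (hL1 : Tendsto (fun n => ∫ x, |f n x - g x| ∂μ) atTop (nhds 0)) :
    (∫ x, g x ∂μ = 1)
    ∧ Tendsto (fun n => ∫ x, |f n x ^ (1/α) - g x ^ (1/α)| ^ α ∂μ) atTop (nhds 0) := by
  have hf_int : ∀ n, Integrable (f n) μ := fun n => by
    by_contra h
    have := hf_one n
    rw [integral_undef h] at this
    exact zero_ne_one this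
  have hg_one : ∫ x, g x ∂μ = 1 := by
    have hbound : ∀ n, |1 - ∫ x, g x ∂μ| ≤ ∫ x, |f n x - g x| ∂μ := fun n => by
      rw [← hf_one n, ← integral_sub (hf_int n) hg_int]
      exact abs_integral_le_integral_abs
    have h := abs_nonpos_iff.1 (ge_of_tendsto' hL1 hbound)
    linarith
  refine ⟨hg_one, ?_⟩
  have hnn : ∀ n, 0 ≤ ∫ x, |f n x ^ (1/α) - g x ^ (1/α)| ^ α ∂μ := fun n =>
    integral_nonneg fun x => Real.rpow_nonneg (abs_nonneg _) _
  rw [Metric.tendsto_atTop']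
  intro ε hε
  obtain ⟨C, hC, hbound⟩ := exists_abs_rpow_sub_rpow_le hα (show 0 < ε / 4 by positivity)
  have hlim : Tendsto (fun n => C * ∫ x, |f n x - g x| ∂μ) atTop (nhds 0) := by
    simpa using hL1.const_mul C
  obtain ⟨N, hN⟩ := eventually_atTop.1 (hlim.eventually (gt_mem_nhds (show 0 < ε / 2 by positivity)))
  refine ⟨N, fun n hn => ?_⟩
  have hsum : Integrable (fun x => ε / 4 * (f n x + g x)) μ :=
    ((hf_int n).add hg_int).const_mul _
  have hdiff : Integrable (fun x => C * |f n x - g x|) μ :=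
    ((hf_int n).sub hg_int).abs.const_mul _
  have hle : ∫ x, |f n x ^ (1/α) - g x ^ (1/α)| ^ α ∂μ
      ≤ ∫ x, (ε / 4 * (f n x + g x) + C * |f n x - g x|) ∂μ :=
    integral_mono_of_nonneg
      (Eventually.of_forall fun x => Real.rpow_nonneg (abs_nonneg _) _) (hsum.add hdiff)
      (Eventually.of_forall fun x => hbound _ _ (hf_nonneg n x) (hg_nonneg x))
  rw [integral_add hsum hdiff, integral_const_mul, integral_const_mul,
    integral_add (hf_int n) hg_int, hf_one n, hg_one] at hle
  rw [Real.dist_eq, sub_zero, abs_of_nonneg (hnn n)]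
  linarith [hN n hn.le]
end

section
/- Fix α>0, α≠1, and a σ-finite measure μ. Let (pₙ) be probability densities with respect to μ with 0 < ∫ pₙ^α dμ < ∞, write Mₙ = (∫ pₙ^α dμ)^{1/α}, and suppose the α-scaled densities pₙ^{(α)} = (pₙ/Mₙ)^α converge in L¹(μ) to a function g with ∫ g dμ = 1. Then the sequence (Mₙ) is bounded, and moreover for every ε>0 and every n, μ({x : pₙ^{(α)}(x) > ε}) ≤ 1/(ε^{1/α} Mₙ). -/
open MeasureTheory Real Filter

/-- Markov's inequality, for the extended-real measure of a superlevel set. -/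
lemma measure_ge_le_ofReal_integral_div {X : Type*} [MeasurableSpace X] {μ : Measure X}
    {f : X → ℝ} (hf : Integrable f μ) (hf0 : ∀ x, 0 ≤ f x) {c : ℝ} (hc : 0 < c) :
    μ {x | c ≤ f x} ≤ ENNReal.ofReal ((∫ x, f x ∂μ) / c) := by
  have hfin : μ {x | c ≤ f x} ≠ ⊤ := (hf.measure_ge_lt_top hc).ne
  have h := mul_meas_ge_le_integral_of_nonneg (Eventually.of_forall hf0) hf c
  rw [← ofReal_measureReal hfin]
  apply ENNReal.ofReal_le_ofReal
  rw [le_div_iff₀ hc]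
  linarith

/-- A function with positive integral exceeds some positive level on a non-null set. -/
lemma exists_pos_measure_lt_ne_zero_of_integral_pos {X : Type*} [MeasurableSpace X]
    {μ : Measure X} {g : X → ℝ} (hg : 0 < ∫ x, g x ∂μ) :
    ∃ c : ℝ, 0 < c ∧ μ {x | c < g x} ≠ 0 := by
  by_contra! h
  have hle : ∀ k : ℕ, ∀ᵐ x ∂μ, g x ≤ 1 / ((k : ℝ) + 1) := fun k => by
    simpa [ae_iff] using h (1 / ((k : ℝ) + 1)) (by positivity)
  have h0 : g ≤ᵐ[μ] 0 := by
    filter_upwards [ae_all_iff.2 hle] with x hx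
    exact ge_of_tendsto' tendsto_one_div_add_atTop_nhds_zero_nat hx
  exact absurd (integral_nonpos_of_ae h0) (not_le.2 hg)

/-- Superlevel sets of the scaled density `(p / M) ^ α` of a probability density `p`. -/
lemma measure_lt_div_rpow_le {X : Type*} [MeasurableSpace X] {μ : Measure X} {α : ℝ}
    (hα : 0 < α) {p : X → ℝ} (hp0 : ∀ x, 0 ≤ p x) (hp1 : ∫ x, p x ∂μ = 1)
    {M : ℝ} (hM : 0 < M) {ε : ℝ} (hε : 0 < ε) :
    μ {x | ε < (p x / M) ^ α} ≤ ENNReal.ofReal (1 / (ε ^ (1/α) * M)) := by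
  have hp : Integrable p μ := .of_integral_ne_zero (by simp [hp1])
  have hmarkov := measure_ge_le_ofReal_integral_div hp hp0 (c := ε ^ (1/α) * M) (by positivity)
  rw [hp1] at hmarkov
  refine (measure_mono fun x hx => ?_).trans hmarkov
  have h0 : 0 ≤ p x / M := div_nonneg (hp0 x) hM.le
  have h : ε ^ (1/α) ≤ ((p x / M) ^ α) ^ (1/α) :=
    rpow_le_rpow hε.le (le_of_lt hx) (by positivity)
  rw [← rpow_mul h0, mul_one_div_cancel hα.ne', rpow_one] at h
  exact (le_div_iff₀ hM).1 h

/-- For `α > 0`, `α ≠ 1`, probability densities `pₙ` with finite positive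
`α`-th power integrals, `Mₙ = (∫ pₙ^α dμ)^{1/α}`, if the `α`-scaled densities
`pₙ^{(α)} = (pₙ/Mₙ)^α` converge in `L¹(μ)` to a function `g` with `∫ g dμ = 1`, then `(Mₙ)` is
bounded, and for every `ε > 0` and every `n`,
`μ({x : pₙ^{(α)}(x) > ε}) ≤ 1/(ε^{1/α} Mₙ)`. -/
theorem norms_bounded_of_scaled_L1_tendsto
    {X : Type*} [MeasurableSpace X] (μ : Measure X) [SigmaFinite μ]
    (α : ℝ) (hα : 0 < α) (hα1 : α ≠ 1)
    (p : ℕ → X → ℝ) (g : X → ℝ)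
    (hp_meas : ∀ n, Measurable (p n)) (hg_meas : Measurable g)
    (hp_nonneg : ∀ n x, 0 ≤ p n x)
    (hp_one : ∀ n, ∫ x, p n x ∂μ = 1)
    (hpα_int : ∀ n, Integrable (fun x => p n x ^ α) μ)
    (hpα_pos : ∀ n, 0 < ∫ x, p n x ^ α ∂μ)
    (hL1 : Tendsto (fun n =>
        ∫ x, |(p n x / (∫ y, p n y ^ α ∂μ) ^ (1/α)) ^ α - g x| ∂μ) atTop (nhds 0))
    (hg_one : ∫ x, g x ∂μ = 1) :
    (∃ C : ℝ, ∀ n, (∫ x, p n x ^ α ∂μ) ^ (1/α) ≤ C)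
    ∧ (∀ ε : ℝ, 0 < ε → ∀ n,
        μ {x | ε < (p n x / (∫ y, p n y ^ α ∂μ) ^ (1/α)) ^ α}
          ≤ ENNReal.ofReal (1 / (ε ^ (1/α) * (∫ y, p n y ^ α ∂μ) ^ (1/α)))) := by
  have hM : ∀ n, 0 < (∫ y, p n y ^ α ∂μ) ^ (1/α) := fun n => rpow_pos_of_pos (hpα_pos n) _
  have htail := fun (ε : ℝ) (hε : 0 < ε) n =>
    measure_lt_div_rpow_le (μ := μ) hα (hp_nonneg n) (hp_one n) (hM n) hε
  refine ⟨?_, htail⟩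
  set M : ℕ → ℝ := fun n => (∫ y, p n y ^ α ∂μ) ^ (1/α) with hMdef
  have hg : Integrable g μ := .of_integral_ne_zero (by simp [hg_one])
  have hq : ∀ n, Integrable (fun x => (p n x / M n) ^ α) μ := fun n => by
    refine ((hpα_int n).div_const (M n ^ α)).congr (Eventually.of_forall fun x => ?_)
    exact (div_rpow (hp_nonneg n x) (hM n).le α).symm
  have hdiff : ∀ n, Integrable (fun x => |(p n x / M n) ^ α - g x|) μ := fun n =>
    ((hq n).sub hg).abs
  obtain ⟨c, hc, hμc⟩ :=
    exists_pos_measure_lt_ne_zero_of_integral_pos (μ := μ) (g := g) (by simp [hg_one])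
  have hfin : μ {x | c < g x} ≠ ⊤ := (hg.measure_gt_lt_top hc).ne
  set δ := μ.real {x | c < g x} with hδ
  have hδ0 : 0 < δ := ENNReal.toReal_pos hμc hfin
  have hε : 0 < c / 2 := by positivity
  have hbound : ∀ n, δ ≤ 1 / ((c / 2) ^ (1/α) * M n)
      + (∫ x, |(p n x / M n) ^ α - g x| ∂μ) / (c / 2) := fun n => by
    have hMn : 0 < M n := hM n
    have hI : 0 ≤ (∫ x, |(p n x / M n) ^ α - g x| ∂μ) / (c / 2) :=
      div_nonneg (integral_nonneg fun _ => abs_nonneg _) hε.le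
    refine ENNReal.toReal_le_of_le_ofReal (by positivity) ?_
    rw [ENNReal.ofReal_add (by positivity) hI]
    refine (measure_mono fun x hx => ?_).trans ((measure_union_le _ _).trans
      (add_le_add (htail (c / 2) hε n)
        (measure_ge_le_ofReal_integral_div (hdiff n) (fun _ => abs_nonneg _) hε)))
    by_cases hx' : c / 2 < (p n x / M n) ^ α
    · exact Or.inl hx'
    · right
      simp only [Set.mem_ofPred_eq] at hx ⊢
      rw [abs_sub_comm]
      exact le_trans (by linarith) (le_abs_self _)
  have hev : ∀ᶠ n in atTop, M n ≤ 2 / (δ * (c / 2) ^ (1/α)) := by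
    have hlt : (0 : ℝ) < δ / 2 * (c / 2) := by positivity
    filter_upwards [hL1.eventually_lt_const hlt] with n hn
    have hMn : 0 < M n := hM n
    have hr : (0 : ℝ) < (c / 2) ^ (1/α) := by positivity
    have h1 : (∫ x, |(p n x / M n) ^ α - g x| ∂μ) / (c / 2) < δ / 2 := (div_lt_iff₀ hε).2 hn
    have h2 : δ / 2 ≤ 1 / ((c / 2) ^ (1/α) * M n) := by linarith [hbound n]
    rw [le_div_iff₀ (by positivity)] at h2 ⊢
    linarith
  obtain ⟨C, hC⟩ := (isBoundedUnder_of_eventually_le hev).bddAbove_range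
  exact ⟨C, fun n => hC ⟨n, rfl⟩⟩
end

section
/- Fix α>0, α≠1, and a σ-finite measure μ. Let Q be a probability measure ≪ μ with density q satisfying 0 < ∫ q^α dμ < ∞, and let 𝔼 be a set of probability measures ≪ μ whose densities p all satisfy 0 < ∫ p^α dμ < ∞. Then inf_{P ∈ 𝔼} 𝓘_α(P,Q) = inf_{P' ∈ 𝔼^{(α)}} D_{1/α}(P' ‖ Q^{(α)}), where 𝔼^{(α)} is the set of α-scaled measures of members of 𝔼; moreover, P₊ ∈ 𝔼 attains the first infimum if and only if its α-scaled measure P₊^{(α)} attains the second infimum. -/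
open MeasureTheory Real

/-- Relative `α`-entropy `𝓘_α(P,Q)` in terms of the `μ`-densities `p, q`:
`(α/(1−α)) log ∫ (p/‖p‖)(q/‖q‖)^{α−1} dμ`, where `‖p‖ = (∫ p^α dμ)^{1/α}`. -/
noncomputable def relAlphaEntropy {X : Type*} [MeasurableSpace X]
    (μ : Measure X) (α : ℝ) (p q : X → ℝ) : ℝ :=
  (α / (1 - α)) * Real.log (∫ x,
    (p x / (∫ y, p y ^ α ∂μ) ^ (1/α)) * (q x / (∫ y, q y ^ α ∂μ) ^ (1/α)) ^ (α - 1) ∂μ)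

/-- Rényi divergence of order `β` in terms of the `μ`-densities:
`D_β(P‖Q) = (1/(β−1)) log ∫ p^β q^{1−β} dμ`. -/
noncomputable def renyiDiv {X : Type*} [MeasurableSpace X]
    (μ : Measure X) (β : ℝ) (p q : X → ℝ) : ℝ :=
  (1 / (β - 1)) * Real.log (∫ x, p x ^ β * q x ^ (1 - β) ∂μ)

/-- The `α`-scaled density `p^{(α)} = p^α / ∫ p^α dμ`. -/
noncomputable def scaledDensity {X : Type*} [MeasurableSpace X]
    (μ : Measure X) (α : ℝ) (p : X → ℝ) : X → ℝ :=
  fun x => p x ^ α / ∫ y, p y ^ α ∂μ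

/-- The relative `α`-entropy of two densities is the Rényi divergence of order `1/α` of their
`α`-scaled densities. -/
theorem renyiDiv_scaledDensity {X : Type*} [MeasurableSpace X] (μ : Measure X) {α : ℝ}
    (hα : α ≠ 0) {p q : X → ℝ} (hp : ∀ x, 0 ≤ p x) (hq : ∀ x, 0 ≤ q x) :
    renyiDiv μ (1 / α) (scaledDensity μ α p) (scaledDensity μ α q) = relAlphaEntropy μ α p q := by
  have hcoef : 1 / (1 / α - 1) = α / (1 - α) := by
    rw [div_sub_one hα, one_div_div]
  have hI : ∀ {f : X → ℝ}, (∀ x, 0 ≤ f x) → 0 ≤ ∫ y, f y ^ α ∂μ := fun hf =>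
    integral_nonneg fun y => Real.rpow_nonneg (hf y) α
  have hscaled : ∀ {f : X → ℝ}, (∀ x, 0 ≤ f x) → ∀ x,
      scaledDensity μ α f x = (f x / (∫ y, f y ^ α ∂μ) ^ (1 / α)) ^ α := fun hf x => by
    rw [Real.div_rpow (hf x) (Real.rpow_nonneg (hI hf) _), ← Real.rpow_mul (hI hf),
      one_div_mul_cancel hα, Real.rpow_one, scaledDensity]
  have hexp : α * (1 - 1 / α) = α - 1 := by field_simp
  unfold renyiDiv relAlphaEntropy
  rw [hcoef]
  congr 3 with x
  have hp' := div_nonneg (hp x) (Real.rpow_nonneg (hI hp) (1 / α))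
  have hq' := div_nonneg (hq x) (Real.rpow_nonneg (hI hq) (1 / α))
  rw [hscaled hp, hscaled hq, ← Real.rpow_mul hp', ← Real.rpow_mul hq', mul_one_div_cancel hα,
    Real.rpow_one, hexp]

/-- For `α > 0`, `α ≠ 1`, a probability density `q` and a set `𝓔` of
probability densities (all with finite positive `α`-th power integrals),
`inf_{P∈𝔼} 𝓘_α(P,Q) = inf_{P'∈𝔼^{(α)}} D_{1/α}(P'‖Q^{(α)})`, and `P₊ ∈ 𝔼` attains the first
infimum iff its `α`-scaled measure attains the second. -/
theorem projection_problems_equivalent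
    {X : Type*} [MeasurableSpace X] (μ : Measure X) [SigmaFinite μ]
    (α : ℝ) (hα : 0 < α) (hα1 : α ≠ 1)
    (q : X → ℝ) (hq_meas : Measurable q) (hq_nonneg : ∀ x, 0 ≤ q x)
    (hq_one : ∫ x, q x ∂μ = 1)
    (hqα_int : Integrable (fun x => q x ^ α) μ) (hqα_pos : 0 < ∫ x, q x ^ α ∂μ)
    (𝓔 : Set (X → ℝ))
    (hmeas : ∀ p ∈ 𝓔, Measurable p) (hnonneg : ∀ p ∈ 𝓔, ∀ x, 0 ≤ p x)
    (hone : ∀ p ∈ 𝓔, ∫ x, p x ∂μ = 1)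
    (hint : ∀ p ∈ 𝓔, Integrable (fun x => p x ^ α) μ)
    (hpos : ∀ p ∈ 𝓔, 0 < ∫ x, p x ^ α ∂μ) :
    sInf ((fun p => relAlphaEntropy μ α p q) '' 𝓔)
      = sInf ((fun p' => renyiDiv μ (1/α) p' (scaledDensity μ α q)) '' (scaledDensity μ α '' 𝓔))
    ∧ ∀ pStar ∈ 𝓔,
      (relAlphaEntropy μ α pStar q = sInf ((fun p => relAlphaEntropy μ α p q) '' 𝓔) ↔
        renyiDiv μ (1/α) (scaledDensity μ α pStar) (scaledDensity μ α q)
          = sInf ((fun p' => renyiDiv μ (1/α) p' (scaledDensity μ α q))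
              '' (scaledDensity μ α '' 𝓔))) := by
  have key : ∀ p ∈ 𝓔, renyiDiv μ (1/α) (scaledDensity μ α p) (scaledDensity μ α q)
      = relAlphaEntropy μ α p q := fun p hp =>
    renyiDiv_scaledDensity μ hα.ne' (hnonneg p hp) hq_nonneg
  rw [Set.image_image, Set.image_congr key]
  exact ⟨rfl, fun p hp => by rw [key p hp]⟩
end

section
/- Let 𝕏 be a finite set, α>0, α≠1, k ≥ 1, f₁,…,f_k : 𝕏 → ℝ, θ = (θ₁,…,θ_k) ∈ ℝ^k, and let Q be a probability measure on 𝕏 with full support. Suppose P_θ is a probability measure on 𝕏 with full support such that for every x ∈ 𝕏, Q(x)^{α−1} + (1−α) Σᵢ θᵢ fᵢ(x) > 0 and P_θ(x)^{−1} = M(θ) (Q(x)^{α−1} + (1−α) Σᵢ θᵢ fᵢ(x))^{1/(1−α)} for a constant M(θ) > 0 (i.e., P_θ belongs to the α-power-law family generated by Q and f₁,…,f_k). Define θ'ᵢ = (−α) θᵢ / ‖Q‖^{α−1}, where ‖Q‖ = (Σ_x Q(x)^α)^{1/α}. Then the α-scaled measure P_θ^{(α)} belongs to the (1/α)-exponential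 family generated by Q^{(α)} and f₁,…,f_k with parameter θ': there exists N > 0 such that for every x ∈ 𝕏, P_θ^{(α)}(x) = N^{−1} ( (Q^{(α)}(x))^{1−1/α} + (1 − 1/α) Σᵢ θ'ᵢ fᵢ(x) )^{1/(1−1/α)}. -/
open Real Finset

/-- Let `𝕏` be a finite set, `α > 0`, `α ≠ 1`, and let `P_θ` be a member of
the `α`-power-law family generated by a fully supported probability measure `Q` and functions
`f₁,…,f_k`, i.e. `P_θ(x)^{-1} = M(θ) (Q(x)^{α−1} + (1−α) Σᵢ θᵢ fᵢ(x))^{1/(1−α)}` with the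
argument positive. With `θ'ᵢ = (−α)θᵢ/‖Q‖^{α−1}` and `‖Q‖ = (Σ_x Q(x)^α)^{1/α}`, the
`α`-scaled measure `P_θ^{(α)}` belongs to the `(1/α)`-exponential family generated by `Q^{(α)}`
and `f₁,…,f_k` with parameter `θ'`. -/
theorem scaled_powerLaw_mem_expFamily
    {𝕏 : Type*} [Fintype 𝕏] [Nonempty 𝕏]
    (α : ℝ) (hα : 0 < α) (hα1 : α ≠ 1)
    (k : ℕ) (hk : 1 ≤ k) (f : Fin k → 𝕏 → ℝ) (θ : Fin k → ℝ)
    (Q : 𝕏 → ℝ) (hQ_pos : ∀ x, 0 < Q x) (hQ_one : ∑ x, Q x = 1)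
    (P : 𝕏 → ℝ) (hP_pos : ∀ x, 0 < P x) (hP_one : ∑ x, P x = 1)
    (M : ℝ) (hM : 0 < M)
    (harg : ∀ x, 0 < Q x ^ (α - 1) + (1 - α) * ∑ i, θ i * f i x)
    (hpow : ∀ x, (P x)⁻¹
        = M * (Q x ^ (α - 1) + (1 - α) * ∑ i, θ i * f i x) ^ (1 / (1 - α)))
    (θ' : Fin k → ℝ)
    (hθ' : ∀ i, θ' i = (-α) * θ i / ((∑ x, Q x ^ α) ^ (1/α)) ^ (α - 1)) :
    ∃ N : ℝ, 0 < N ∧ ∀ x,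
      P x ^ α / ∑ y, P y ^ α
        = N⁻¹ * ((Q x ^ α / ∑ y, Q y ^ α) ^ (1 - 1/α)
            + (1 - 1/α) * ∑ i, θ' i * f i x) ^ (1 / (1 - 1/α)) := by
  have hZ : 0 < ∑ y, Q y ^ α := sum_pos (fun y _ => rpow_pos_of_pos (hQ_pos y) α) univ_nonempty
  have hT : 0 < ∑ y, P y ^ α := sum_pos (fun y _ => rpow_pos_of_pos (hP_pos y) α) univ_nonempty
  set Z := ∑ y, Q y ^ α
  set T := ∑ y, P y ^ α
  have hα0 : α ≠ 0 := hα.ne'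
  have h1 : 1 - α ≠ 0 := sub_ne_zero.2 hα1.symm
  have h2 : α - 1 ≠ 0 := sub_ne_zero.2 hα1
  have hexp : 1 / (1 - 1 / α) = -(1 / (1 - α) * α) := by
    have h3 : 1 - 1 / α = (α - 1) / α := by field_simp
    rw [h3, one_div_div, ← neg_sub α 1]
    field_simp
  set W := (Z ^ (1 / α)) ^ (α - 1) with hW
  have hWpos : 0 < W := by positivity
  have hWZ : Z ^ (1 - 1 / α) = W := by
    rw [hW, ← rpow_mul hZ.le]
    congr 1
    field_simp
  refine ⟨M ^ α * T / W ^ (1 / (1 - 1 / α)), by positivity, fun x => ?_⟩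
  have hbase : (Q x ^ α / Z) ^ (1 - 1 / α) + (1 - 1 / α) * ∑ i, θ' i * f i x
      = (Q x ^ (α - 1) + (1 - α) * ∑ i, θ i * f i x) / W := by
    have hsum : ∑ i, θ' i * f i x = -α / W * ∑ i, θ i * f i x := by
      rw [mul_sum]
      refine sum_congr rfl fun i _ => ?_
      rw [hθ']
      ring
    have hmul : α * (1 - 1 / α) = α - 1 := by field_simp
    rw [div_rpow (rpow_pos_of_pos (hQ_pos x) α).le hZ.le, ← rpow_mul (hQ_pos x).le, hmul,
      hWZ, hsum]
    field_simp
    ring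
  have hA := harg x
  have hPx := hpow x
  rw [hbase]
  set A := Q x ^ (α - 1) + (1 - α) * ∑ i, θ i * f i x
  have hPα : P x ^ α = (M ^ α)⁻¹ * A ^ (1 / (1 - 1 / α)) := by
    rw [← inv_inv (P x), hPx, inv_rpow (by positivity), mul_rpow hM.le (by positivity),
      ← rpow_mul hA.le, hexp, rpow_neg hA.le, mul_inv]
  rw [hPα, div_rpow hA.le hWpos.le]
  have hWe : 0 < W ^ (1 / (1 - 1 / α)) := rpow_pos_of_pos hWpos _
  have hMα : 0 < M ^ α := rpow_pos_of_pos hM _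
  generalize W ^ (1 / (1 - 1 / α)) = w at hWe ⊢
  generalize A ^ (1 / (1 - 1 / α)) = a
  field_simp
end

section
/- Let 𝕏 be a finite set, α>0, α≠1, Φ ⊆ ℝⁿ open, and let φ ↦ p_φ be a twice continuously differentiable map from Φ to the strictly positive probability vectors on 𝕏. Then for all i,j ∈ {1,…,n} and φ ∈ Φ, the Eguchi metric coefficient of the Rényi divergence, g^{(D_α)}_{i,j}(φ) = −(∂/∂φᵢ)(∂/∂φ'ⱼ) D_α(p_φ ‖ p_{φ'}) evaluated at φ' = φ, equals α Σ_{x∈𝕏} p_φ(x) (∂ᵢ log p_φ(x)) (∂ⱼ log p_φ(x)); that is, the Riemannian metric induced by D_α via Eguchi's construction is α times the Fisher information metric. -/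
open Real Finset

/-- The partial derivative of `F : ℝⁿ → ℝ` at `φ` in the `i`-th coordinate direction. -/
noncomputable def partialDeriv {n : ℕ} (F : (Fin n → ℝ) → ℝ) (φ : Fin n → ℝ) (i : Fin n) : ℝ :=
  fderiv ℝ F φ (Pi.single i 1)

/-- `partialDeriv` reads off the Fréchet derivative. -/
theorem HasFDerivAt.partialDeriv_eq {n : ℕ} {F : (Fin n → ℝ) → ℝ} {F' : (Fin n → ℝ) →L[ℝ] ℝ}
    {φ : Fin n → ℝ} (h : HasFDerivAt F F' φ) (i : Fin n) :
    partialDeriv F φ i = F' (Pi.single i 1) := by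
  rw [partialDeriv, h.fderiv]

/-- The Fréchet derivative of `ψ ↦ ∑ x, w x * p ψ x ^ r` at a point where `p` is positive. -/
theorem hasFDerivAt_sum_mul_rpow {𝕏 E : Type*} [Fintype 𝕏] [NormedAddCommGroup E]
    [NormedSpace ℝ E] {p : E → 𝕏 → ℝ} {φ : E} {p' : 𝕏 → E →L[ℝ] ℝ}
    (hp : ∀ x, HasFDerivAt (fun ψ => p ψ x) (p' x) φ) (hpos : ∀ x, 0 < p φ x)
    (w : 𝕏 → ℝ) (r : ℝ) :
    HasFDerivAt (fun ψ => ∑ x, w x * p ψ x ^ r)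
      (∑ x, w x • (r * p φ x ^ (r - 1)) • p' x) φ :=
  HasFDerivAt.fun_sum fun x _ => ((hp x).rpow_const (Or.inl (hpos x).ne')).const_mul (w x)

/-- For a C² family `φ ↦ p_φ` of strictly positive probability vectors on a
finite set `𝕏` (with `φ` in an open set `Φ ⊆ ℝⁿ`), the Eguchi metric coefficient of the Rényi
divergence `D_α(p_φ‖p_{φ'}) = (1/(α−1)) log Σ_x p_φ(x)^α p_{φ'}(x)^{1−α}`, namely
`−(∂/∂φᵢ)(∂/∂φ'ⱼ) D_α(p_φ‖p_{φ'})|_{φ'=φ}`, equals `α` times the Fisher information metric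
coefficient `Σ_x p_φ(x)(∂ᵢ log p_φ(x))(∂ⱼ log p_φ(x))`. -/
theorem eguchi_renyi_eq_alpha_mul_fisher
    {𝕏 : Type*} [Fintype 𝕏] [Nonempty 𝕏]
    {n : ℕ} (Φ : Set (Fin n → ℝ)) (hΦ : IsOpen Φ)
    (α : ℝ) (hα : 0 < α) (hα1 : α ≠ 1)
    (p : (Fin n → ℝ) → 𝕏 → ℝ)
    (hsmooth : ∀ x, ContDiffOn ℝ 2 (fun ψ => p ψ x) Φ)
    (hpos : ∀ ψ ∈ Φ, ∀ x, 0 < p ψ x)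
    (hone : ∀ ψ ∈ Φ, ∑ x, p ψ x = 1)
    (i j : Fin n) (φ : Fin n → ℝ) (hφ : φ ∈ Φ) :
    -(partialDeriv (fun ψ => partialDeriv
        (fun ψ' => (1/(α-1)) * Real.log (∑ x, p ψ x ^ α * p ψ' x ^ (1-α))) φ j) φ i)
    = α * ∑ x, p φ x * partialDeriv (fun ψ => Real.log (p ψ x)) φ i
        * partialDeriv (fun ψ => Real.log (p ψ x)) φ j := by
  have hΦφ : Φ ∈ nhds φ := hΦ.mem_nhds hφ
  have hp : ∀ x, ∃ p', HasFDerivAt (fun ψ => p ψ x) p' φ := fun x =>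
    ⟨_, (((hsmooth x).contDiffAt hΦφ).differentiableAt (by norm_num)).hasFDerivAt⟩
  choose p' hp using hp
  have hposφ := hpos φ hφ
  let b : 𝕏 → ℝ := fun x => p' x (Pi.single j 1)
  let N : (Fin n → ℝ) → ℝ := fun ψ => ∑ x, (p φ x ^ (-α) * b x) * p ψ x ^ α
  let S : (Fin n → ℝ) → ℝ := fun ψ => ∑ x, p φ x ^ (1 - α) * p ψ x ^ α
  have hα1' : α - 1 ≠ 0 := sub_ne_zero.mpr hα1
  have hinner : ∀ ψ ∈ Φ, partialDeriv
      (fun ψ' => (1/(α-1)) * Real.log (∑ x, p ψ x ^ α * p ψ' x ^ (1-α))) φ j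
      = -(N ψ / S ψ) := by
    intro ψ hψ
    have hSpos : 0 < ∑ x, p ψ x ^ α * p φ x ^ (1 - α) :=
      Finset.sum_pos (fun x _ => mul_pos (rpow_pos_of_pos (hpos ψ hψ x) _)
        (rpow_pos_of_pos (hposφ x) _)) Finset.univ_nonempty
    have hS_eq : S ψ = ∑ x, p ψ x ^ α * p φ x ^ (1 - α) :=
      Finset.sum_congr rfl fun x _ => mul_comm _ _
    have hN_eq : (∑ x, p ψ x ^ α • ((1 - α) * p φ x ^ (1 - α - 1)) • p' x) (Pi.single j 1)
        = (1 - α) * N ψ := by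
      simp only [N, _root_.sum_apply, smul_apply, smul_eq_mul,
        Finset.mul_sum, b, sub_sub_cancel_left]
      exact Finset.sum_congr rfl fun x _ => by ring
    rw [(((hasFDerivAt_sum_mul_rpow hp hposφ (fun x => p ψ x ^ α) (1 - α)).log
      hSpos.ne').const_mul (1 / (α - 1))).partialDeriv_eq j, smul_apply,
      smul_apply, hN_eq, hS_eq]
    have := hSpos.ne'
    simp only [smul_eq_mul]
    field_simp
    ring
  have hSφ : S φ = 1 := by
    rw [← hone φ hφ]
    refine Finset.sum_congr rfl fun x _ => ?_
    rw [← rpow_add (hposφ x), sub_add_cancel, rpow_one]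
  have hNφ : N φ = 0 := by
    have hconst : HasFDerivAt (fun ψ => ∑ x, p ψ x) (0 : (Fin n → ℝ) →L[ℝ] ℝ) φ :=
      (hasFDerivAt_const (1 : ℝ) φ).congr_of_eventuallyEq
        (Filter.eventually_of_mem hΦφ fun ψ hψ => hone ψ hψ)
    have hsum := (HasFDerivAt.fun_sum fun x (_ : x ∈ Finset.univ) => hp x).unique hconst
    calc N φ = (∑ x, p' x) (Pi.single j 1) := by
          rw [_root_.sum_apply]
          refine Finset.sum_congr rfl fun x _ => ?_
          rw [mul_right_comm, ← rpow_add (hposφ x), neg_add_cancel, rpow_zero, one_mul]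
      _ = 0 := by rw [hsum, zero_apply]
  have hNd := hasFDerivAt_sum_mul_rpow hp hposφ (fun x => p φ x ^ (-α) * b x) α
  have hSd := hasFDerivAt_sum_mul_rpow hp hposφ (fun x => p φ x ^ (1 - α)) α
  have hSinv := (hasDerivAt_inv (hSφ.trans_ne one_ne_zero)).comp_hasFDerivAt φ hSd
  have houter := ((HasFDerivAt.mul hNd hSinv).neg).congr_of_eventuallyEq
    (Filter.eventually_of_mem hΦφ hinner)
  have hlog : ∀ x k, partialDeriv (fun ψ => Real.log (p ψ x)) φ k
      = (p φ x)⁻¹ * p' x (Pi.single k 1) := fun x k =>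
    ((hp x).log (hposφ x).ne').partialDeriv_eq k
  rw [houter.partialDeriv_eq i]
  change - -(N φ • _ + (S φ)⁻¹ • _ : (Fin n → ℝ) →L[ℝ] ℝ) (Pi.single i 1) = _
  rw [hNφ, hSφ, zero_smul, zero_add, inv_one, one_smul, neg_neg, _root_.sum_apply, Finset.mul_sum]
  refine Finset.sum_congr rfl fun x _ => ?_
  have hpow : p φ x ^ (-α) * p φ x ^ (α - 1) = (p φ x)⁻¹ := by
    rw [← rpow_add (hposφ x), ← rpow_neg_one]
    congr 1
    ring
  simp only [smul_apply, smul_eq_mul, hlog]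
  calc p φ x ^ (-α) * b x * (α * p φ x ^ (α - 1) * p' x (Pi.single i 1))
      = α * ((p φ x ^ (-α) * p φ x ^ (α - 1)) * p' x (Pi.single i 1) * b x) := by ring
    _ = _ := by
      rw [hpow]
      have := (hposφ x).ne'
      field_simp
      rfl
end

section
/- Let 𝕏 be a finite set, α>0, α≠1, Φ ⊆ ℝⁿ open, and let φ ↦ p_φ be a twice continuously differentiable map from Φ to the strictly positive probability vectors on 𝕏. Then for all i,j and all φ ∈ Φ, the Eguchi metric coefficient of relative α-entropy on the family {p_φ} equals the Eguchi metric coefficient of the Rényi divergence of order 1/α on the family of α-scaled measures {p_φ^{(α)}}: −(∂/∂φᵢ)(∂/∂φ'ⱼ) 𝓘_α(p_φ, p_{φ'})|_{φ'=φ} = −(∂/∂φᵢ)(∂/∂φ'ⱼ) D_{1/α}(p_φ^{(α)} ‖ p_{φ'}^{(α)})|_{φ'=φ}. -/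
open Real Finset

/-- Relative `α`-entropy between strictly positive probability vectors on a finite set:
`𝓘_α(p,q) = (α/(1−α)) log Σ_x (p(x)/‖p‖)(q(x)/‖q‖)^{α−1}`, `‖p‖ = (Σ_x p(x)^α)^{1/α}`. -/
noncomputable def relAlphaEnt {𝕏 : Type*} [Fintype 𝕏] (α : ℝ) (p q : 𝕏 → ℝ) : ℝ :=
  (α / (1 - α)) * Real.log (∑ x,
    (p x / (∑ y, p y ^ α) ^ (1/α)) * (q x / (∑ y, q y ^ α) ^ (1/α)) ^ (α - 1))

/-- Rényi divergence of order `β` between strictly positive probability vectors: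
`D_β(p‖q) = (1/(β−1)) log Σ_x p(x)^β q(x)^{1−β}`. -/
noncomputable def renyiDivFin {𝕏 : Type*} [Fintype 𝕏] (β : ℝ) (p q : 𝕏 → ℝ) : ℝ :=
  (1 / (β - 1)) * Real.log (∑ x, p x ^ β * q x ^ (1 - β))

/-- The `α`-scaled probability vector `p^{(α)}(x) = p(x)^α / Σ_y p(y)^α`. -/
noncomputable def scaledVec {𝕏 : Type*} [Fintype 𝕏] (α : ℝ) (p : 𝕏 → ℝ) : 𝕏 → ℝ :=
  fun x => p x ^ α / ∑ y, p y ^ α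

/-- Relative `α`-entropy is the Rényi divergence of order `1/α` between `α`-scaled measures. -/
theorem relAlphaEnt_eq_renyiDivFin_scaledVec {𝕏 : Type*} [Fintype 𝕏] {α : ℝ} (hα : α ≠ 0)
    {p q : 𝕏 → ℝ} (hp : ∀ x, 0 ≤ p x) (hq : ∀ x, 0 ≤ q x) :
    relAlphaEnt α p q = renyiDivFin (1 / α) (scaledVec α p) (scaledVec α q) := by
  have hsum {r : 𝕏 → ℝ} (hr : ∀ x, 0 ≤ r x) : 0 ≤ ∑ y, r y ^ α :=
    Finset.sum_nonneg fun y _ => Real.rpow_nonneg (hr y) α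
  have hroot {r : 𝕏 → ℝ} (hr : ∀ x, 0 ≤ r x) (x : 𝕏) :
      scaledVec α r x ^ (1 / α) = r x / (∑ y, r y ^ α) ^ (1 / α) := by
    rw [scaledVec, Real.div_rpow (Real.rpow_nonneg (hr x) α) (hsum hr), ← Real.rpow_mul (hr x),
      mul_one_div_cancel hα, Real.rpow_one]
  have hcoef : α / (1 - α) = 1 / (1 / α - 1) := by
    rw [show 1 / α - 1 = (1 - α) / α by field_simp, one_div_div]
  unfold relAlphaEnt renyiDivFin
  rw [hcoef]
  congr 2
  refine Finset.sum_congr rfl fun x _ => ?_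
  have hexp : 1 - 1 / α = 1 / α * (α - 1) := by field_simp
  have hscaled : 0 ≤ scaledVec α q x := div_nonneg (Real.rpow_nonneg (hq x) α) (hsum hq)
  rw [hroot hp, hexp, Real.rpow_mul hscaled, hroot hq]

theorem partialDeriv_congr {n : ℕ} {F G : (Fin n → ℝ) → ℝ} {φ : Fin n → ℝ}
    (h : F =ᶠ[nhds φ] G) (i : Fin n) : partialDeriv F φ i = partialDeriv G φ i := by
  rw [partialDeriv, partialDeriv, h.fderiv_eq]

/-- For a C² family `φ ↦ p_φ` of strictly positive probability vectors on a
finite set, the Eguchi metric coefficient of relative `α`-entropy on `{p_φ}` equals the Eguchi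
metric coefficient of the Rényi divergence of order `1/α` on the family `{p_φ^{(α)}}` of
`α`-scaled measures. -/
theorem eguchi_relAlphaEnt_eq_eguchi_renyi_scaled
    {𝕏 : Type*} [Fintype 𝕏] [Nonempty 𝕏]
    {n : ℕ} (Φ : Set (Fin n → ℝ)) (hΦ : IsOpen Φ)
    (α : ℝ) (hα : 0 < α) (hα1 : α ≠ 1)
    (p : (Fin n → ℝ) → 𝕏 → ℝ)
    (hsmooth : ∀ x, ContDiffOn ℝ 2 (fun ψ => p ψ x) Φ)
    (hpos : ∀ ψ ∈ Φ, ∀ x, 0 < p ψ x)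
    (hone : ∀ ψ ∈ Φ, ∑ x, p ψ x = 1)
    (i j : Fin n) (φ : Fin n → ℝ) (hφ : φ ∈ Φ) :
    -(partialDeriv (fun ψ => partialDeriv
        (fun ψ' => relAlphaEnt α (p ψ) (p ψ')) φ j) φ i)
    = -(partialDeriv (fun ψ => partialDeriv
        (fun ψ' => renyiDivFin (1/α) (scaledVec α (p ψ)) (scaledVec α (p ψ'))) φ j) φ i) := by
  have hev : ∀ᶠ ψ in nhds φ, ψ ∈ Φ := hΦ.mem_nhds hφ
  refine congrArg Neg.neg (partialDeriv_congr ?_ i)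
  filter_upwards [hev] with ψ hψ
  refine partialDeriv_congr ?_ j
  filter_upwards [hev] with ψ' hψ'
  exact relAlphaEnt_eq_renyiDivFin_scaledVec hα.ne' (fun x => (hpos ψ hψ x).le)
    (fun x => (hpos ψ' hψ' x).le)
end

section
/- Let 𝕏 be a finite set, α>0, α≠1, Φ ⊆ ℝⁿ open, and let φ ↦ p_φ be a twice continuously differentiable map from Φ to the strictly positive probability vectors on 𝕏. Then for all i,j and all φ ∈ Φ, the Eguchi metric coefficient of relative α-entropy on the family {p_φ} equals 1/α times the Fisher information metric of the family of α-scaled measures: −(∂/∂φᵢ)(∂/∂φ'ⱼ) 𝓘_α(p_φ, p_{φ'})|_{φ'=φ} = (1/α) Σ_{x∈𝕏} p_φ^{(α)}(x) (∂ᵢ log p_φ^{(α)}(x)) (∂ⱼ log p_φ^{(α)}(x)). -/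
open Real Finset

open Topology

section Scaled

variable {𝕏 : Type*} [Fintype 𝕏] [Nonempty 𝕏] {p q : 𝕏 → ℝ}

lemma sum_rpow_pos (α : ℝ) (hp : ∀ x, 0 < p x) : 0 < ∑ y, p y ^ α :=
  Finset.sum_pos (fun y _ => Real.rpow_pos_of_pos (hp y) α) Finset.univ_nonempty

lemma scaledVec_pos (α : ℝ) (hp : ∀ x, 0 < p x) (x : 𝕏) : 0 < scaledVec α p x :=
  div_pos (Real.rpow_pos_of_pos (hp x) α) (sum_rpow_pos α hp)

lemma sum_scaledVec (α : ℝ) (hp : ∀ x, 0 < p x) : ∑ x, scaledVec α p x = 1 := by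
  simp only [scaledVec, ← Finset.sum_div]
  exact div_self (sum_rpow_pos α hp).ne'

lemma log_div_norm {α : ℝ} (hα : α ≠ 0) (hp : ∀ x, 0 < p x) (x : 𝕏) :
    Real.log (p x / (∑ y, p y ^ α) ^ (1 / α)) = 1 / α * Real.log (scaledVec α p x) := by
  have hS := sum_rpow_pos α hp
  rw [scaledVec, Real.log_div (hp x).ne' (Real.rpow_pos_of_pos hS _).ne',
    Real.log_div (Real.rpow_pos_of_pos (hp x) α).ne' hS.ne', Real.log_rpow hS,
    Real.log_rpow (hp x)]
  field_simp

/-- Relative `α`-entropy in terms of the logarithms of the `α`-scaled measures. -/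
lemma relAlphaEnt_eq_log_sum_exp {α : ℝ} (hα : α ≠ 0) (hp : ∀ x, 0 < p x)
    (hq : ∀ x, 0 < q x) :
    relAlphaEnt α p q = α / (1 - α) * Real.log (∑ x,
      Real.exp (1 / α * Real.log (scaledVec α p x)
        + (α - 1) / α * Real.log (scaledVec α q x))) := by
  unfold relAlphaEnt
  congr 2
  refine Finset.sum_congr rfl fun x _ => ?_
  have hu : 0 < p x / (∑ y, p y ^ α) ^ (1 / α) :=
    div_pos (hp x) (Real.rpow_pos_of_pos (sum_rpow_pos α hp) _)
  have hv : 0 < q x / (∑ y, q y ^ α) ^ (1 / α) :=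
    div_pos (hq x) (Real.rpow_pos_of_pos (sum_rpow_pos α hq) _)
  rw [Real.exp_add, ← log_div_norm hα hp x, Real.exp_log hu, Real.rpow_def_of_pos hv,
    log_div_norm hα hq x]
  ring_nf

end Scaled

section LogSumExp

variable {𝕏 E : Type*} [Fintype 𝕏] [NormedAddCommGroup E] [NormedSpace ℝ E]

lemma fderiv_const_mul_field (c : ℝ) (f : E → ℝ) (φ : E) :
    fderiv ℝ (fun ψ => c * f ψ) φ = c • fderiv ℝ f φ :=
  congrFun (fderiv_const_smul_field c) φ

lemma hasFDerivAt_sum_mul_exp {l : 𝕏 → E → ℝ} {L : 𝕏 → E →L[ℝ] ℝ} {φ : E}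
    (hl : ∀ x, HasFDerivAt (l x) (L x) φ) (a b : 𝕏 → ℝ) (t : ℝ) :
    HasFDerivAt (fun ψ => ∑ x, a x * Real.exp (t * l x ψ + b x))
      (∑ x, (a x * Real.exp (t * l x φ + b x) * t) • L x) φ := by
  refine HasFDerivAt.fun_sum fun x _ => ?_
  refine ((((hl x).const_mul t).add_const (b x)).exp.const_mul (a x)).congr_fderiv ?_
  simp only [smul_smul, mul_assoc]

/-- The mixed derivative on the diagonal of `log ∑ₓ exp (s lₓ(ψ) + t lₓ(ψ'))`, where
`s + t = 1` and `exp ∘ l` is a family of probability vectors. -/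
lemma fderiv_fderiv_log_sum_exp {l : 𝕏 → E → ℝ} {φ : E}
    (hl : ∀ x, DifferentiableAt ℝ (l x) φ)
    (hsum : ∀ᶠ ψ in 𝓝 φ, ∑ x, Real.exp (l x ψ) = 1) {s t : ℝ} (hst : s + t = 1) (u v : E) :
    fderiv ℝ (fun ψ => fderiv ℝ
        (fun ψ' => Real.log (∑ x, Real.exp (s * l x ψ + t * l x ψ'))) φ v) φ u
      = s * t * ∑ x, Real.exp (l x φ) * fderiv ℝ (l x) φ u * fderiv ℝ (l x) φ v := by
  have hL := fun x => (hl x).hasFDerivAt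
  have hX : Nonempty 𝕏 := by
    by_contra h
    rw [not_nonempty_iff] at h
    simpa using hsum.self_of_nhds
  have hexp : ∀ x, s * l x φ + t * l x φ = l x φ := fun x => by rw [← add_mul, hst, one_mul]
  have hpos : ∀ ψ, 0 < ∑ x, Real.exp (s * l x ψ + t * l x φ) := fun ψ =>
    Finset.sum_pos (fun x _ => Real.exp_pos _) Finset.univ_nonempty
  have hinner : ∀ ψ, fderiv ℝ
      (fun ψ' => Real.log (∑ x, Real.exp (s * l x ψ + t * l x ψ'))) φ v
        = (∑ x, t * fderiv ℝ (l x) φ v * Real.exp (s * l x ψ + t * l x φ))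
          * (∑ x, 1 * Real.exp (s * l x ψ + t * l x φ))⁻¹ := fun ψ => by
    have h : HasFDerivAt (fun ψ' => ∑ x, Real.exp (s * l x ψ + t * l x ψ'))
        (∑ x, (Real.exp (s * l x ψ + t * l x φ) * t) • fderiv ℝ (l x) φ) φ := by
      simpa only [one_mul, add_comm] using
        hasFDerivAt_sum_mul_exp hL (fun _ => 1) (fun x => s * l x ψ) t
    simp only [one_mul]
    rw [(h.log (hpos ψ).ne').fderiv]
    simp only [smul_apply, _root_.sum_apply, smul_eq_mul]
    rw [mul_comm]
    congr 1
    exact Finset.sum_congr rfl fun x _ => by ring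
  have hzero : ∑ x, Real.exp (l x φ) * fderiv ℝ (l x) φ v = 0 := by
    have h := hasFDerivAt_sum_mul_exp hL (fun _ => 1) (fun _ => 0) 1
    simp only [one_mul, add_zero, mul_one] at h
    have h0 := h.unique ((hasFDerivAt_const (1 : ℝ) φ).congr_of_eventuallyEq hsum)
    simpa using congrArg (fun M : E →L[ℝ] ℝ => M v) h0
  have hN := hasFDerivAt_sum_mul_exp hL (fun x => t * fderiv ℝ (l x) φ v)
    (fun x => t * l x φ) s
  have hD := hasFDerivAt_sum_mul_exp hL (fun _ => 1) (fun x => t * l x φ) s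
  have hD1 : ∑ x, 1 * Real.exp (s * l x φ + t * l x φ) = 1 := by
    simpa only [one_mul, hexp] using hsum.self_of_nhds
  have hN0 : ∑ x, t * fderiv ℝ (l x) φ v * Real.exp (s * l x φ + t * l x φ) = 0 := by
    rw [← mul_zero t, ← hzero, Finset.mul_sum]
    exact Finset.sum_congr rfl fun x _ => by rw [hexp]; ring
  have hDinv : HasFDerivAt (fun ψ => (∑ x, 1 * Real.exp (s * l x ψ + t * l x φ))⁻¹) _ φ :=
    (hasDerivAt_inv (hD1.trans_ne one_ne_zero)).comp_hasFDerivAt φ hD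
  simp only [hinner]
  rw [(hN.fun_mul hDinv).fderiv, hD1, hN0]
  simp only [hexp, zero_smul, zero_add, one_smul, inv_one,
    _root_.sum_apply, smul_apply, smul_eq_mul, Finset.mul_sum]
  exact Finset.sum_congr rfl fun x _ => by ring

end LogSumExp

/-- For a C² family `φ ↦ p_φ` of strictly positive probability vectors on a
finite set, the Eguchi metric coefficient of relative `α`-entropy on `{p_φ}` equals `1/α` times
the Fisher information metric coefficient of the family `{p_φ^{(α)}}` of `α`-scaled measures:
`Σ_x p_φ^{(α)}(x)(∂ᵢ log p_φ^{(α)}(x))(∂ⱼ log p_φ^{(α)}(x))`. -/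
theorem eguchi_relAlphaEnt_eq_invAlpha_mul_fisher_scaled
    {𝕏 : Type*} [Fintype 𝕏] [Nonempty 𝕏]
    {n : ℕ} (Φ : Set (Fin n → ℝ)) (hΦ : IsOpen Φ)
    (α : ℝ) (hα : 0 < α) (hα1 : α ≠ 1)
    (p : (Fin n → ℝ) → 𝕏 → ℝ)
    (hsmooth : ∀ x, ContDiffOn ℝ 2 (fun ψ => p ψ x) Φ)
    (hpos : ∀ ψ ∈ Φ, ∀ x, 0 < p ψ x)
    (hone : ∀ ψ ∈ Φ, ∑ x, p ψ x = 1)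
    (i j : Fin n) (φ : Fin n → ℝ) (hφ : φ ∈ Φ) :
    -(partialDeriv (fun ψ => partialDeriv
        (fun ψ' => relAlphaEnt α (p ψ) (p ψ')) φ j) φ i)
    = (1/α) * ∑ x, scaledVec α (p φ) x
        * partialDeriv (fun ψ => Real.log (scaledVec α (p ψ) x)) φ i
        * partialDeriv (fun ψ => Real.log (scaledVec α (p ψ) x)) φ j := by
  have hα0 := hα.ne'
  have hα1' : 1 - α ≠ 0 := sub_ne_zero.mpr hα1.symm
  have hev : ∀ᶠ ψ in 𝓝 φ, ψ ∈ Φ := hΦ.mem_nhds hφ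
  have hdiff : ∀ x, DifferentiableAt ℝ (fun ψ => p ψ x) φ := fun x =>
    ((hsmooth x).contDiffAt (hΦ.mem_nhds hφ)).differentiableAt two_ne_zero
  have hpow : ∀ x, DifferentiableAt ℝ (fun ψ => p ψ x ^ α) φ := fun x =>
    (hdiff x).rpow_const (Or.inl (hpos φ hφ x).ne')
  have hl : ∀ x, DifferentiableAt ℝ (fun ψ => Real.log (scaledVec α (p ψ) x)) φ := fun x => by
    have hS : DifferentiableAt ℝ (fun ψ => ∑ y, p ψ y ^ α) φ :=
      DifferentiableAt.fun_sum fun y _ => hpow y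
    have hs : DifferentiableAt ℝ (fun ψ => scaledVec α (p ψ) x) φ := by
      simp only [scaledVec, div_eq_mul_inv]
      exact (hpow x).fun_mul (hS.fun_inv (sum_rpow_pos α (hpos φ hφ)).ne')
    exact hs.log (scaledVec_pos α (hpos φ hφ) x).ne'
  have hsum : ∀ᶠ ψ in 𝓝 φ, ∑ x, Real.exp (Real.log (scaledVec α (p ψ) x)) = 1 := by
    filter_upwards [hev] with ψ hψ
    rw [← sum_scaledVec α (hpos ψ hψ)]
    exact Finset.sum_congr rfl fun x _ => Real.exp_log (scaledVec_pos α (hpos ψ hψ) x)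
  have key := fderiv_fderiv_log_sum_exp hl hsum (s := 1 / α) (t := (α - 1) / α)
    (by field_simp; ring) (Pi.single i 1) (Pi.single j 1)
  have hent : (fun ψ => partialDeriv (fun ψ' => relAlphaEnt α (p ψ) (p ψ')) φ j) =ᶠ[𝓝 φ]
      fun ψ => α / (1 - α) * fderiv ℝ (fun ψ' => Real.log (∑ x,
        Real.exp (1 / α * Real.log (scaledVec α (p ψ) x)
          + (α - 1) / α * Real.log (scaledVec α (p ψ') x)))) φ (Pi.single j 1) := by
    filter_upwards [hev] with ψ hψ
    have h : (fun ψ' => relAlphaEnt α (p ψ) (p ψ')) =ᶠ[𝓝 φ] fun ψ' => α / (1 - α) *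
        Real.log (∑ x, Real.exp (1 / α * Real.log (scaledVec α (p ψ) x)
          + (α - 1) / α * Real.log (scaledVec α (p ψ') x))) := by
      filter_upwards [hev] with ψ' hψ'
      exact relAlphaEnt_eq_log_sum_exp hα0 (hpos ψ hψ) (hpos ψ' hψ')
    rw [partialDeriv, h.fderiv_eq, fderiv_const_mul_field, smul_apply, smul_eq_mul]
  unfold partialDeriv at hent ⊢
  rw [hent.fderiv_eq, fderiv_const_mul_field, smul_apply, key, smul_eq_mul]
  simp only [Real.exp_log (scaledVec_pos α (hpos φ hφ) _)]
  field_simp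
  ring
end

section
/- Fix α>0, α≠1, and a σ-finite measure μ. Let (pₙ) be probability densities with respect to μ with 0 < ∫ pₙ^α dμ < ∞, suppose the α-scaled densities pₙ^{(α)} converge in L¹(μ) to a function g with ∫ g dμ = 1, and suppose ‖pₙ‖ = (∫ pₙ^α dμ)^{1/α} converges to some c > 0 and pₙ converges in the L^α(μ) metric to a probability density q with 0 < ∫ q^α dμ < ∞. Then c = ‖q‖ and g = (q/‖q‖)^α μ-almost everywhere; in particular g is the α-scaled density of a probability density, namely of q. -/
open MeasureTheory Real Filter

/-- A sequence of nonnegative integrable functions whose integrals tend to zero has a subsequence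
tending to zero almost everywhere. -/
theorem exists_subseq_tendsto_zero_ae_of_integral_tendsto_zero
    {X : Type*} [MeasurableSpace X] {μ : Measure X} {F : ℕ → X → ℝ}
    (hF : ∀ n, Integrable (F n) μ) (hF_nonneg : ∀ n x, 0 ≤ F n x)
    (hlim : Tendsto (fun n => ∫ x, F n x ∂μ) atTop (nhds 0)) :
    ∃ φ : ℕ → ℕ, StrictMono φ ∧
      ∀ᵐ x ∂μ, Tendsto (fun k => F (φ k) x) atTop (nhds 0) := by
  have hnorm : Tendsto (fun n => eLpNorm (F n - fun _ => (0 : ℝ)) 1 μ) atTop (nhds 0) := by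
    have heq : ∀ n, eLpNorm (F n - fun _ => (0 : ℝ)) 1 μ = ENNReal.ofReal (∫ x, F n x ∂μ) := by
      intro n
      rw [ofReal_integral_eq_lintegral_ofReal (hF n) (Eventually.of_forall (hF_nonneg n)),
        eLpNorm_one_eq_lintegral_enorm]
      refine lintegral_congr fun x => ?_
      simp [Real.enorm_of_nonneg (hF_nonneg n x)]
    simp_rw [heq]
    simpa using ENNReal.tendsto_ofReal hlim
  exact (tendstoInMeasure_of_tendsto_eLpNorm one_ne_zero
    (fun n => (hF n).aestronglyMeasurable) aestronglyMeasurable_const hnorm).exists_seq_tendsto_ae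

/-- For nonnegative reals, `|a - b| ^ α ≤ a ^ α + b ^ α` for every positive exponent. -/
theorem abs_sub_rpow_le_add_rpow {a b α : ℝ} (ha : 0 ≤ a) (hb : 0 ≤ b) (hα : 0 < α) :
    |a - b| ^ α ≤ a ^ α + b ^ α := by
  rcases le_total a b with h | h
  · have h1 : |a - b| ^ α ≤ b ^ α :=
      Real.rpow_le_rpow (abs_nonneg _) (abs_le.2 ⟨by linarith, by linarith⟩) hα.le
    linarith [Real.rpow_nonneg ha α]
  · have h1 : |a - b| ^ α ≤ a ^ α :=
      Real.rpow_le_rpow (abs_nonneg _) (abs_le.2 ⟨by linarith, by linarith⟩) hα.le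
    linarith [Real.rpow_nonneg hb α]

/-- For `α > 0`, `α ≠ 1`, probability densities `pₙ` with finite positive
`α`-th power integrals whose `α`-scaled densities converge in `L¹(μ)` to `g` with `∫ g dμ = 1`,
if `‖pₙ‖ = (∫ pₙ^α dμ)^{1/α} → c > 0` and `pₙ → q` in the `L^α(μ)` metric for a probability
density `q` with finite positive `α`-th power integral, then `c = ‖q‖` and
`g = (q/‖q‖)^α` `μ`-a.e.; in particular `g` is the `α`-scaled density of `q`. -/
theorem limit_is_scaled_density_of_limit
    {X : Type*} [MeasurableSpace X] (μ : Measure X) [SigmaFinite μ]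
    (α : ℝ) (hα : 0 < α) (hα1 : α ≠ 1)
    (p : ℕ → X → ℝ) (g : X → ℝ) (q : X → ℝ) (c : ℝ)
    (hp_meas : ∀ n, Measurable (p n)) (hg_meas : Measurable g) (hq_meas : Measurable q)
    (hp_nonneg : ∀ n x, 0 ≤ p n x) (hq_nonneg : ∀ x, 0 ≤ q x)
    (hp_one : ∀ n, ∫ x, p n x ∂μ = 1) (hq_one : ∫ x, q x ∂μ = 1)
    (hpα_int : ∀ n, Integrable (fun x => p n x ^ α) μ)
    (hqα_int : Integrable (fun x => q x ^ α) μ)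
    (hpα_pos : ∀ n, 0 < ∫ x, p n x ^ α ∂μ) (hqα_pos : 0 < ∫ x, q x ^ α ∂μ)
    (hL1 : Tendsto (fun n =>
        ∫ x, |(p n x / (∫ y, p n y ^ α ∂μ) ^ (1/α)) ^ α - g x| ∂μ) atTop (nhds 0))
    (hg_one : ∫ x, g x ∂μ = 1)
    (hc_pos : 0 < c)
    (hc : Tendsto (fun n => (∫ x, p n x ^ α ∂μ) ^ (1/α)) atTop (nhds c))
    (hLα : Tendsto (fun n => ∫ x, |p n x - q x| ^ α ∂μ) atTop (nhds 0)) :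
    c = (∫ x, q x ^ α ∂μ) ^ (1/α)
    ∧ g =ᵐ[μ] fun x => (q x / (∫ y, q y ^ α ∂μ) ^ (1/α)) ^ α := by
  have hg_int : Integrable g μ := by
    by_contra h
    rw [integral_undef h] at hg_one
    exact zero_ne_one hg_one
  have hscaled_int : ∀ n,
      Integrable (fun x => (p n x / (∫ y, p n y ^ α ∂μ) ^ (1/α)) ^ α) μ := by
    intro n
    have heq : (fun x => (p n x / (∫ y, p n y ^ α ∂μ) ^ (1/α)) ^ α)
        = fun x => p n x ^ α / ((∫ y, p n y ^ α ∂μ) ^ (1/α)) ^ α :=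
      funext fun x =>
        Real.div_rpow (hp_nonneg n x) (Real.rpow_nonneg (hpα_pos n).le _) α
    rw [heq]
    exact (hpα_int n).div_const _
  have hA : ∀ n, Integrable
      (fun x => |(p n x / (∫ y, p n y ^ α ∂μ) ^ (1/α)) ^ α - g x|) μ :=
    fun n => ((hscaled_int n).sub hg_int).abs
  have hB : ∀ n, Integrable (fun x => |p n x - q x| ^ α) μ := by
    intro n
    refine ((hpα_int n).add hqα_int).mono'
      (((hp_meas n).sub hq_meas).norm.pow_const α).aestronglyMeasurable
      (Eventually.of_forall fun x => ?_)
    rw [Real.norm_of_nonneg (Real.rpow_nonneg (abs_nonneg _) _)]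
    exact abs_sub_rpow_le_add_rpow (hp_nonneg n x) (hq_nonneg x) hα
  have hsum : Tendsto (fun n => ∫ x, (|(p n x / (∫ y, p n y ^ α ∂μ) ^ (1/α)) ^ α - g x|
      + |p n x - q x| ^ α) ∂μ) atTop (nhds 0) := by
    simp_rw [fun n => integral_add (hA n) (hB n)]
    simpa using hL1.add hLα
  obtain ⟨φ, hφ, hae⟩ := exists_subseq_tendsto_zero_ae_of_integral_tendsto_zero
    (fun n => (hA n).add (hB n))
    (fun n x => add_nonneg (abs_nonneg _) (Real.rpow_nonneg (abs_nonneg _) _)) hsum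
  have hg_eq : g =ᵐ[μ] fun x => (q x / c) ^ α := by
    filter_upwards [hae] with x hx
    have h1 : Tendsto (fun k => (p (φ k) x / (∫ y, p (φ k) y ^ α ∂μ) ^ (1/α)) ^ α)
        atTop (nhds (g x)) := by
      rw [tendsto_iff_norm_sub_tendsto_zero]
      exact squeeze_zero (fun k => norm_nonneg _)
        (fun k => le_add_of_nonneg_right (Real.rpow_nonneg (abs_nonneg _) _)) hx
    have h2 : Tendsto (fun k => |p (φ k) x - q x| ^ α) atTop (nhds 0) :=
      squeeze_zero (fun k => Real.rpow_nonneg (abs_nonneg _) _)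
        (fun k => le_add_of_nonneg_left (abs_nonneg _)) hx
    have h3 : Tendsto (fun k => p (φ k) x) atTop (nhds (q x)) := by
      rw [tendsto_iff_norm_sub_tendsto_zero]
      have h4 := h2.rpow_const (p := α⁻¹) (Or.inr (inv_nonneg.2 hα.le))
      rw [Real.zero_rpow (inv_ne_zero hα.ne')] at h4
      refine h4.congr fun k => ?_
      exact Real.rpow_rpow_inv (abs_nonneg _) hα.ne'
    exact tendsto_nhds_unique h1
      ((h3.div (hc.comp hφ.tendsto_atTop) hc_pos.ne').rpow_const (Or.inr hα.le))
  have hc_eq : c = (∫ x, q x ^ α ∂μ) ^ (1/α) := by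
    have h1 : ∫ x, (q x / c) ^ α ∂μ = (∫ x, q x ^ α ∂μ) / c ^ α := by
      simp_rw [fun x => Real.div_rpow (hq_nonneg x) hc_pos.le α]
      exact integral_div _ _
    rw [integral_congr_ae hg_eq, h1, div_eq_one_iff_eq (Real.rpow_pos_of_pos hc_pos α).ne']
      at hg_one
    rw [hg_one, one_div, Real.rpow_rpow_inv hc_pos.le hα.ne']
  exact ⟨hc_eq, hc_eq ▸ hg_eq⟩
end
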